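/- 7 · √3 · (Γ(1/3))^3 / (π · 2^{1/3}) = Σ_{n=0}^∞ (2/3)_n · (1/2)_n · (102n + 59) / ((13/12)_n · (19/12)_n · (-288)^n), where the series converges absolutely. -/

import Mathlib

open Real

/-- Rising factorial (Pochhammer symbol): `(a)_n = ∏_{i=0}^{n-1} (a + i)`. -/
noncomputable def risingFactorial (a : ℝ) (n : ℕ) : ℝ := ∏ i ∈ Finset.range n, (a + i)

open MeasureTheory Set

/-- The real Euler beta integrand is integrable on `(0, 1)`. -/
theorem integrableOn_beta_integrand {a b : ℝ} (ha : 0 < a) (hb : 0 < b) :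
    IntegrableOn (fun x : ℝ => x ^ (a - 1) * (1 - x) ^ (b - 1)) (Ioo 0 1) := by
  have h := Complex.betaIntegral_convergent (u := a) (v := b) (by simpa) (by simpa)
  rw [intervalIntegrable_iff_integrableOn_Ioo_of_le zero_le_one] at h
  refine (IntegrableOn.congr_fun (Integrable.re h) (fun x hx => ?_) measurableSet_Ioo)
  have h1 : (0 : ℝ) ≤ x := hx.1.le
  have h2 : (0 : ℝ) ≤ 1 - x := by linarith [hx.2]
  have : (x : ℂ) ^ ((a : ℂ) - 1) * (1 - (x : ℂ)) ^ ((b : ℂ) - 1) =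
      ((x ^ (a - 1) * (1 - x) ^ (b - 1) : ℝ) : ℂ) := by
    push_cast [Complex.ofReal_cpow h1, Complex.ofReal_cpow h2]
    rfl
  simp only [this]
  exact Complex.ofReal_re _

/-- The Euler beta integral over the reals. -/
theorem integral_Ioo_beta_integrand {a b : ℝ} (ha : 0 < a) (hb : 0 < b) :
    ∫ x in Ioo (0 : ℝ) 1, x ^ (a - 1) * (1 - x) ^ (b - 1) =
      Gamma a * Gamma b / Gamma (a + b) := by
  have h := Complex.betaIntegral_eq_Gamma_mul_div a b (by simpa) (by simpa)
  rw [Complex.betaIntegral, intervalIntegral.integral_of_le zero_le_one,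
    integral_Ioc_eq_integral_Ioo] at h
  have h' : ∫ x in Ioo (0 : ℝ) 1, (x : ℂ) ^ ((a : ℂ) - 1) * (1 - (x : ℂ)) ^ ((b : ℂ) - 1) =
      ∫ x in Ioo (0 : ℝ) 1, ((x ^ (a - 1) * (1 - x) ^ (b - 1) : ℝ) : ℂ) := by
    refine setIntegral_congr_fun measurableSet_Ioo fun x hx => ?_
    have h1 : (0 : ℝ) ≤ x := hx.1.le
    have h2 : (0 : ℝ) ≤ 1 - x := by linarith [hx.2]
    push_cast [Complex.ofReal_cpow h1, Complex.ofReal_cpow h2]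
    rfl
  rw [h', integral_complex_ofReal, Complex.Gamma_ofReal, Complex.Gamma_ofReal,
    ← Complex.ofReal_add, Complex.Gamma_ofReal] at h
  exact_mod_cast h

theorem hasDerivAt_half_log_div {t : ℝ} (h1 : -1 < t) (h2 : t < 1) :
    HasDerivAt (fun t : ℝ => 1 / 2 * log ((1 + t) / (1 - t))) (1 / (1 - t ^ 2)) t := by
  have p1 : 1 + t ≠ 0 := by linarith
  have p2 : 1 - t ≠ 0 := by linarith
  have h := ((((hasDerivAt_id t).const_add 1).div ((hasDerivAt_id t).const_sub 1) p2).log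
    (div_ne_zero p1 p2)).const_mul (1 / 2)
  refine h.congr_deriv ?_
  have p3 : 1 - t ^ 2 ≠ 0 := by
    have : 1 - t ^ 2 = (1 + t) * (1 - t) := by ring
    rw [this]; exact mul_ne_zero p1 p2
  simp only [id, Pi.div_apply]
  field_simp
  ring

/-- An elementary primitive of the pseudo-elliptic differential `w / ((8 + w³) √(1 - w³))`. -/
noncomputable def pseudoEllipticPrimitive (w : ℝ) : ℝ :=
  1 / 18 * (1 / 2 * log ((1 + (1 - w) * √(1 - w) / (3 * √(1 + w + w ^ 2))) /
      (1 - (1 - w) * √(1 - w) / (3 * √(1 + w + w ^ 2)))) -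
    1 / 2 * log ((1 + √(1 - w) * √(1 + w + w ^ 2) / 3) /
      (1 - √(1 - w) * √(1 + w + w ^ 2) / 3)) -
    √3 * arctan (√3 * √(1 - w) / √(1 + w + w ^ 2)))

theorem primitive_arguments_lt_one {w : ℝ} (h0 : 0 ≤ w) (h1 : w ≤ 1) :
    (1 - w) * √(1 - w) / (3 * √(1 + w + w ^ 2)) < 1 ∧
      √(1 - w) * √(1 + w + w ^ 2) / 3 < 1 := by
  have hr : √(1 - w) ≤ 1 := Real.sqrt_le_one.mpr (by linarith)
  have hr0 := Real.sqrt_nonneg (1 - w)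
  have hs : 1 ≤ √(1 + w + w ^ 2) := Real.one_le_sqrt.mpr (by nlinarith)
  have hs2 : √(1 + w + w ^ 2) ≤ 2 := Real.sqrt_le_iff.mpr ⟨by norm_num, by nlinarith⟩
  constructor
  · rw [div_lt_one (by linarith)]
    nlinarith
  · rw [div_lt_one (by norm_num)]
    nlinarith

theorem continuousOn_pseudoEllipticPrimitive :
    ContinuousOn pseudoEllipticPrimitive (Icc 0 1) := by
  intro w hw
  obtain ⟨h0, h1⟩ := hw
  obtain ⟨hu, hy⟩ := primitive_arguments_lt_one h0 h1
  have hs : 0 < √(1 + w + w ^ 2) := Real.sqrt_pos.mpr (by nlinarith)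
  have hu0 : 0 ≤ (1 - w) * √(1 - w) / (3 * √(1 + w + w ^ 2)) := by
    have : 0 ≤ 1 - w := by linarith
    positivity
  have hy0 : 0 ≤ √(1 - w) * √(1 + w + w ^ 2) / 3 := by positivity
  refine ContinuousAt.continuousWithinAt ?_
  refine ContinuousAt.mul continuousAt_const (ContinuousAt.sub (ContinuousAt.sub ?_ ?_) ?_)
  · refine ContinuousAt.comp (f := fun w : ℝ => (1 - w) * √(1 - w) / (3 * √(1 + w + w ^ 2)))
      (hasDerivAt_half_log_div (by linarith) hu).continuousAt ?_
    exact ContinuousAt.div (by fun_prop) (by fun_prop) (by positivity)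
  · refine ContinuousAt.comp (f := fun w : ℝ => √(1 - w) * √(1 + w + w ^ 2) / 3)
      (hasDerivAt_half_log_div (by linarith) hy).continuousAt ?_
    fun_prop
  · refine ContinuousAt.mul continuousAt_const
      (Real.continuous_arctan.continuousAt.comp (ContinuousAt.div ?_ ?_ hs.ne'))
    · fun_prop
    · fun_prop

theorem hasDerivAt_pseudoEllipticPrimitive {w : ℝ} (h0 : 0 < w) (h1 : w < 1) :
    HasDerivAt pseudoEllipticPrimitive (w / ((8 + w ^ 3) * √(1 - w ^ 3))) w := by
  obtain ⟨hu, hy⟩ := primitive_arguments_lt_one h0.le h1.le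
  have hr : 0 < √(1 - w) := Real.sqrt_pos.mpr (by linarith)
  have hs : 0 < √(1 + w + w ^ 2) := Real.sqrt_pos.mpr (by nlinarith)
  have hu0 : 0 ≤ (1 - w) * √(1 - w) / (3 * √(1 + w + w ^ 2)) := by
    have : 0 ≤ 1 - w := by linarith
    positivity
  have hy0 : 0 ≤ √(1 - w) * √(1 + w + w ^ 2) / 3 := by positivity
  have hr2 : √(1 - w) ^ 2 = 1 - w := Real.sq_sqrt (by linarith)
  have hs2 : √(1 + w + w ^ 2) ^ 2 = 1 + w + w ^ 2 := Real.sq_sqrt (by nlinarith)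
  have h32 : √3 ^ 2 = 3 := Real.sq_sqrt (by norm_num)
  have hprod : √(1 - w ^ 3) = √(1 - w) * √(1 + w + w ^ 2) := by
    rw [← Real.sqrt_mul (by linarith)]
    congr 1
    ring
  have dr : HasDerivAt (fun w : ℝ => √(1 - w)) (-1 / (2 * √(1 - w))) w :=
    ((hasDerivAt_id w).const_sub 1).sqrt (by simp only [id]; linarith)
  have ds : HasDerivAt (fun w : ℝ => √(1 + w + w ^ 2))
      ((1 + 2 * w) / (2 * √(1 + w + w ^ 2))) w := by
    have := (((hasDerivAt_id w).const_add 1).add ((hasDerivAt_id w).pow 2)).sqrt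
      (by simp only [Pi.add_apply, Pi.pow_apply, id]; nlinarith)
    refine this.congr_deriv ?_
    simp
  have du : HasDerivAt (fun w : ℝ => (1 - w) * √(1 - w) / (3 * √(1 + w + w ^ 2)))
      (-(w + 2) ^ 2 * √(1 - w) / (6 * √(1 + w + w ^ 2) * (1 + w + w ^ 2))) w := by
    refine ((((hasDerivAt_id w).const_sub 1).mul dr).div (ds.const_mul 3)
      (by positivity)).congr_deriv ?_
    simp only [Pi.mul_apply, id]
    rw [mul_pow, hs2]
    field_simp
    rw [hr2, hs2]
    ring
  have dy : HasDerivAt (fun w : ℝ => √(1 - w) * √(1 + w + w ^ 2) / 3)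
      (-w ^ 2 / (2 * √(1 - w) * √(1 + w + w ^ 2))) w := by
    refine ((dr.mul ds).div_const 3).congr_deriv ?_
    field_simp
    rw [hr2, hs2]
    ring
  have dv : HasDerivAt (fun w : ℝ => √3 * √(1 - w) / √(1 + w + w ^ 2))
      (√3 * (w ^ 2 - 2 * w - 2) / (2 * √(1 - w) * √(1 + w + w ^ 2) * (1 + w + w ^ 2))) w := by
    refine ((dr.const_mul (√3)).div ds hs.ne').congr_deriv ?_
    rw [hs2]
    field_simp
    rw [hr2, hs2]
    ring
  have D1 := (hasDerivAt_half_log_div (by linarith) hu).comp w du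
  have D2 := (hasDerivAt_half_log_div (by linarith) hy).comp w dy
  have D3 := dv.arctan.const_mul (√3)
  refine (((D1.sub D2).sub D3).const_mul (1 / 18)).congr_deriv ?_
  have e1 : 1 - ((1 - w) * √(1 - w) / (3 * √(1 + w + w ^ 2))) ^ 2 =
      (w + 2) ^ 3 / (9 * (1 + w + w ^ 2)) := by
    rw [div_pow, mul_pow, mul_pow, hr2, hs2]
    field_simp
    ring
  have e2 : 1 - (√(1 - w) * √(1 + w + w ^ 2) / 3) ^ 2 = (8 + w ^ 3) / 9 := by
    rw [div_pow, mul_pow, hr2, hs2]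
    ring
  have e3 : 1 + (√3 * √(1 - w) / √(1 + w + w ^ 2)) ^ 2 =
      (w ^ 2 - 2 * w + 4) / (1 + w + w ^ 2) := by
    rw [div_pow, mul_pow, hr2, hs2, h32]
    field_simp
    ring
  have hf : 8 + w ^ 3 = (w + 2) * (w ^ 2 - 2 * w + 4) := by ring
  have q0 : 0 < w ^ 2 - 2 * w + 4 := by nlinarith
  rw [hprod, e1, e2, e3, hf]
  generalize hQ : w ^ 2 - 2 * w + 4 = Q at *
  field_simp
  rw [hr2, h32, ← hQ]
  ring

theorem integrableOn_beta_weight :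
    IntegrableOn (fun x : ℝ => x ^ (-1 / 3 : ℝ) * (1 - x) ^ (-1 / 2 : ℝ)) (Ioo 0 1) := by
  have h := integrableOn_beta_integrand (a := 2 / 3) (b := 1 / 2) (by norm_num) (by norm_num)
  norm_num at h ⊢
  exact h

theorem integral_pseudoElliptic :
    ∫ x in Ioo (0 : ℝ) 1, x ^ (-1 / 3 : ℝ) * (1 - x) ^ (-1 / 2 : ℝ) / (8 + x) =
      √3 * π / 18 := by
  have hint : IntegrableOn
      (fun x : ℝ => x ^ (-1 / 3 : ℝ) * (1 - x) ^ (-1 / 2 : ℝ) / (8 + x)) (Ioo 0 1) := by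
    refine Integrable.mono' integrableOn_beta_weight (Measurable.aestronglyMeasurable (by fun_prop)) ?_
    refine (ae_restrict_iff' measurableSet_Ioo).mpr (Filter.Eventually.of_forall fun x hx => ?_)
    obtain ⟨h0, h1⟩ := hx
    have h2 : 0 < 1 - x := by linarith
    rw [Real.norm_of_nonneg (by positivity)]
    exact div_le_self (by positivity) (by linarith)
  have key := intervalIntegral.integral_eq_sub_of_hasDerivAt_of_le (a := 0) (b := 1)
    (f := fun x : ℝ => 3 * pseudoEllipticPrimitive (x ^ (1 / 3 : ℝ)))
    (f' := fun x : ℝ => x ^ (-1 / 3 : ℝ) * (1 - x) ^ (-1 / 2 : ℝ) / (8 + x))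
    zero_le_one ?_ ?_ ?_
  · rw [intervalIntegral.integral_of_le zero_le_one, integral_Ioc_eq_integral_Ioo] at key
    rw [key]
    have hz : (0 : ℝ) ^ (1 / 3 : ℝ) = 0 := Real.zero_rpow (by norm_num)
    simp only [hz, Real.one_rpow, pseudoEllipticPrimitive]
    norm_num
    ring
  · refine continuousOn_const.mul (continuousOn_pseudoEllipticPrimitive.comp ?_ ?_)
    · exact (Real.continuous_rpow_const (by norm_num)).continuousOn
    · intro x hx
      exact ⟨Real.rpow_nonneg hx.1 _, Real.rpow_le_one hx.1 hx.2 (by norm_num)⟩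
  · rintro x ⟨h0, h1⟩
    have hw0 : 0 < x ^ (1 / 3 : ℝ) := Real.rpow_pos_of_pos h0 _
    have hw1 : x ^ (1 / 3 : ℝ) < 1 := Real.rpow_lt_one h0.le h1 (by norm_num)
    have hw3 : (x ^ (1 / 3 : ℝ)) ^ 3 = x := by
      rw [← Real.rpow_natCast, ← Real.rpow_mul h0.le]
      norm_num
    have h2 : 0 < 1 - x := by linarith
    refine (((hasDerivAt_pseudoEllipticPrimitive hw0 hw1).comp x
      (Real.hasDerivAt_rpow_const (Or.inl h0.ne'))).const_mul 3).congr_deriv ?_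
    rw [hw3, show (1 / 3 - 1 : ℝ) = -1 / 3 + -1 / 3 by norm_num, Real.rpow_add h0,
      Real.sqrt_eq_rpow, show (-1 / 2 : ℝ) = -(1 / 2) by norm_num, Real.rpow_neg h2.le,
      show (-1 / 3 : ℝ) = -(1 / 3) by norm_num, Real.rpow_neg h0.le]
    field_simp
  · rw [intervalIntegrable_iff_integrableOn_Ioo_of_le zero_le_one]
    exact hint

theorem Gamma_add_nat_eq_risingFactorial {a : ℝ} (ha : 0 < a) (n : ℕ) :
    Gamma (a + n) = risingFactorial a n * Gamma a := by
  induction n with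
  | zero => simp [risingFactorial]
  | succ n ih =>
    rw [Nat.cast_succ, ← add_assoc, Real.Gamma_add_one (by positivity), ih]
    simp only [risingFactorial, Finset.prod_range_succ]
    ring

theorem risingFactorial_two_mul (a : ℝ) (n : ℕ) :
    risingFactorial (2 * a) (2 * n) =
      4 ^ n * risingFactorial a n * risingFactorial (a + 1 / 2) n := by
  induction n with
  | zero => simp [risingFactorial]
  | succ n ih =>
    rw [show 2 * (n + 1) = 2 * n + 1 + 1 by ring]
    simp only [risingFactorial, Finset.prod_range_succ] at ih ⊢
    rw [ih]
    push_cast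
    ring

theorem risingFactorial_pos {a : ℝ} (ha : 0 < a) (n : ℕ) : 0 < risingFactorial a n :=
  Finset.prod_pos fun i _ => by positivity

/-- The series coefficients, up to a common constant, as beta-type integrals. -/
theorem integral_beta_weight_eq_term (n : ℕ) :
    ∫ x in Ioo (0 : ℝ) 1, x ^ (-1 / 3 : ℝ) * (1 - x) ^ (-1 / 2 : ℝ) * (54 - 6 * x) *
        (-(x * (1 - x)) / 72) ^ n =
      Gamma (2 / 3) * Gamma (1 / 2) / Gamma (13 / 6) *
        (risingFactorial (2 / 3) n * risingFactorial (1 / 2) n * (102 * (n : ℝ) + 59) /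
          (risingFactorial (13 / 12) n * risingFactorial (19 / 12) n * (-288 : ℝ) ^ n)) := by
  have ha : (0 : ℝ) < 2 / 3 + n := by positivity
  have ha' : (0 : ℝ) < 5 / 3 + n := by positivity
  have hb : (0 : ℝ) < 1 / 2 + n := by positivity
  have h1 : ∫ x in Ioo (0 : ℝ) 1, x ^ (-1 / 3 : ℝ) * (1 - x) ^ (-1 / 2 : ℝ) * (54 - 6 * x) *
        (-(x * (1 - x)) / 72) ^ n = ∫ x in Ioo (0 : ℝ) 1,
        (54 * (-1 / 72) ^ n * (x ^ (2 / 3 + n - 1 : ℝ) * (1 - x) ^ (1 / 2 + n - 1 : ℝ)) -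
          6 * (-1 / 72) ^ n * (x ^ (5 / 3 + n - 1 : ℝ) * (1 - x) ^ (1 / 2 + n - 1 : ℝ))) := by
    refine setIntegral_congr_fun measurableSet_Ioo fun x hx => ?_
    obtain ⟨h0, h1⟩ := hx
    have h2 : 0 < 1 - x := by linarith
    rw [show (2 / 3 + n - 1 : ℝ) = -1 / 3 + n by ring,
      show (5 / 3 + n - 1 : ℝ) = -1 / 3 + n + 1 by ring,
      show (1 / 2 + n - 1 : ℝ) = -1 / 2 + n by ring, Real.rpow_add_one h0.ne',
      Real.rpow_add_natCast h0.ne', Real.rpow_add_natCast h2.ne',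
      show -(x * (1 - x)) / 72 = (-1 / 72) * x * (1 - x) by ring, mul_pow, mul_pow]
    ring
  rw [h1, integral_sub ((integrableOn_beta_integrand ha hb).const_mul _)
    ((integrableOn_beta_integrand ha' hb).const_mul _), integral_const_mul, integral_const_mul,
    integral_Ioo_beta_integrand ha hb, integral_Ioo_beta_integrand ha' hb]
  have g1 : Gamma (5 / 3 + n) = (2 / 3 + n) * Gamma (2 / 3 + n) := by
    rw [← Real.Gamma_add_one ha.ne']
    congr 1
    ring
  have g2 : Gamma (13 / 6 + (2 * n : ℕ)) = (7 / 6 + 2 * n) * Gamma (2 / 3 + n + (1 / 2 + n)) := by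
    rw [show (2 / 3 + n + (1 / 2 + n) : ℝ) = 7 / 6 + 2 * n by ring,
      ← Real.Gamma_add_one (by positivity)]
    congr 1
    push_cast
    ring
  have g3 : Gamma (5 / 3 + n + (1 / 2 + n)) = Gamma (13 / 6 + (2 * n : ℕ)) := by
    congr 1
    push_cast
    ring
  have g4 : Gamma (2 / 3 + n + (1 / 2 + n)) = Gamma (13 / 6 + (2 * n : ℕ)) / (7 / 6 + 2 * n) := by
    rw [g2]
    field_simp
  rw [g3, g4, g1, Gamma_add_nat_eq_risingFactorial (by norm_num),
    Gamma_add_nat_eq_risingFactorial (by norm_num),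
    Gamma_add_nat_eq_risingFactorial (by norm_num),
    show (13 / 6 : ℝ) = 2 * (13 / 12) by norm_num, risingFactorial_two_mul,
    show (13 / 12 + 1 / 2 : ℝ) = 19 / 12 by norm_num,
    show (-288 : ℝ) = (-1 / 72)⁻¹ * 4 by norm_num, mul_pow, inv_pow]
  have p1 := risingFactorial_pos (a := 13 / 12) (by norm_num) n
  have p2 := risingFactorial_pos (a := 19 / 12) (by norm_num) n
  have p3 : 0 < Gamma (2 * (13 / 12)) := Real.Gamma_pos_of_pos (by norm_num)
  have p4 : ((-1 / 72 : ℝ)) ^ n ≠ 0 := pow_ne_zero _ (by norm_num)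
  generalize ((-1 / 72 : ℝ)) ^ n = z at *
  field_simp
  ring

theorem hasSum_integral_beta_weight :
    HasSum (fun n : ℕ => ∫ x in Ioo (0 : ℝ) 1, x ^ (-1 / 3 : ℝ) * (1 - x) ^ (-1 / 2 : ℝ) *
      (54 - 6 * x) * (-(x * (1 - x)) / 72) ^ n) (24 * √3 * π) := by
  have hval : ∫ x in Ioo (0 : ℝ) 1,
      432 * (x ^ (-1 / 3 : ℝ) * (1 - x) ^ (-1 / 2 : ℝ) / (8 + x)) = 24 * √3 * π := by
    rw [integral_const_mul, integral_pseudoElliptic]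
    ring
  have hgeo : Summable fun n : ℕ => (1 / 72 : ℝ) ^ n :=
    summable_geometric_of_lt_one (by norm_num) (by norm_num)
  rw [← hval]
  refine hasSum_integral_of_dominated_convergence
    (fun n x => 54 * (x ^ (-1 / 3 : ℝ) * (1 - x) ^ (-1 / 2 : ℝ)) * (1 / 72) ^ n)
    (fun n => by fun_prop) (fun n => ?_) ?_ ?_ ?_
  · refine (ae_restrict_iff' measurableSet_Ioo).mpr (Filter.Eventually.of_forall fun x hx => ?_)
    obtain ⟨h0, h1⟩ := hx
    have h2 : 0 < 1 - x := by linarith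
    have hx1 : |-(x * (1 - x)) / 72| ≤ 1 / 72 := by
      rw [abs_le]
      constructor <;> nlinarith
    rw [norm_mul, norm_pow, norm_mul, Real.norm_of_nonneg
      (show 0 ≤ x ^ (-1 / 3 : ℝ) * (1 - x) ^ (-1 / 2 : ℝ) by positivity),
      Real.norm_of_nonneg (show 0 ≤ 54 - 6 * x by linarith), Real.norm_eq_abs]
    refine mul_le_mul ?_ (pow_le_pow_left₀ (abs_nonneg _) hx1 n) (by positivity) (by positivity)
    rw [mul_comm]
    exact mul_le_mul_of_nonneg_right (by linarith) (by positivity)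
  · exact Filter.Eventually.of_forall fun x => hgeo.mul_left _
  · simp only [tsum_mul_left]
    exact (integrableOn_beta_weight.const_mul 54).mul_const _
  · refine (ae_restrict_iff' measurableSet_Ioo).mpr (Filter.Eventually.of_forall fun x hx => ?_)
    obtain ⟨h0, h1⟩ := hx
    have hx1 : |-(x * (1 - x)) / 72| < 1 := by
      rw [abs_lt]
      constructor <;> nlinarith
    have h := (hasSum_geometric_of_abs_lt_one hx1).mul_left
      (x ^ (-1 / 3 : ℝ) * (1 - x) ^ (-1 / 2 : ℝ) * (54 - 6 * x))
    have h9 : 0 < 9 - x := by linarith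
    have e : 432 * (x ^ (-1 / 3 : ℝ) * (1 - x) ^ (-1 / 2 : ℝ) / (8 + x)) =
        x ^ (-1 / 3 : ℝ) * (1 - x) ^ (-1 / 2 : ℝ) * (54 - 6 * x) *
          (1 - -(x * (1 - x)) / 72)⁻¹ := by
      rw [show 1 - -(x * (1 - x)) / 72 = (9 - x) * (8 + x) / 72 by ring]
      field_simp
      ring
    rw [e]
    exact h

theorem Gamma_evaluation :
    7 * √3 * Gamma (1 / 3) ^ 3 / (π * (2 : ℝ) ^ ((1 : ℝ) / 3)) =
      24 * √3 * π / (Gamma (2 / 3) * Gamma (1 / 2) / Gamma (13 / 6)) := by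
  have hG : 0 < Gamma (1 / 3) := Real.Gamma_pos_of_pos (by norm_num)
  have hG2 : 0 < Gamma (2 / 3) := Real.Gamma_pos_of_pos (by norm_num)
  have hp := Real.pi_pos
  have h3 : √3 ^ 2 = 3 := Real.sq_sqrt (by norm_num)
  have h30 : 0 < √3 := Real.sqrt_pos.mpr (by norm_num)
  have hsp : 0 < √π := Real.sqrt_pos.mpr hp
  have hrefl : Gamma (1 / 3) * Gamma (2 / 3) = 2 * π / √3 := by
    have h := Real.Gamma_mul_Gamma_one_sub (1 / 3)
    rw [show (1 - 1 / 3 : ℝ) = 2 / 3 by norm_num, show π * (1 / 3) = π / 3 by ring,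
      Real.sin_pi_div_three] at h
    rw [h]
    field_simp
  have hdup : Gamma (1 / 6) * Gamma (2 / 3) = Gamma (1 / 3) * (2 : ℝ) ^ (2 / 3 : ℝ) * √π := by
    have h := Real.Gamma_mul_Gamma_add_half (1 / 6)
    norm_num at h ⊢
    exact h
  have h13 : Gamma (13 / 6) = 7 / 36 * Gamma (1 / 6) := by
    rw [show (13 / 6 : ℝ) = 1 / 6 + 1 + 1 by norm_num, Real.Gamma_add_one (by norm_num),
      Real.Gamma_add_one (by norm_num)]
    ring
  have h2 : (2 : ℝ) ^ (2 / 3 : ℝ) * (2 : ℝ) ^ ((1 : ℝ) / 3) = 2 := by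
    rw [← Real.rpow_add (by norm_num)]
    norm_num
  have h20 : 0 < (2 : ℝ) ^ ((1 : ℝ) / 3) := by positivity
  have e1 : Gamma (2 / 3) = 2 * π / √3 / Gamma (1 / 3) := by
    rw [← hrefl]
    field_simp
  have e2 : Gamma (1 / 6) = Gamma (1 / 3) * (2 : ℝ) ^ (2 / 3 : ℝ) * √π / Gamma (2 / 3) := by
    rw [← hdup]
    field_simp
  have e3 : (2 : ℝ) ^ (2 / 3 : ℝ) = 2 / (2 : ℝ) ^ ((1 : ℝ) / 3) := by
    rw [eq_div_iff h20.ne', h2]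
  rw [h13, e2, e1, e3, Real.Gamma_one_half_eq]
  generalize (2 : ℝ) ^ ((1 : ℝ) / 3) = t at *
  field_simp
  rw [h3]
  norm_num

theorem stmt2 :
    Summable (fun n : ℕ =>
      |risingFactorial (2 / 3) n * risingFactorial (1 / 2) n * (102 * (n : ℝ) + 59) /
        (risingFactorial (13 / 12) n * risingFactorial (19 / 12) n * (-288 : ℝ) ^ n)|) ∧
    7 * Real.sqrt 3 * (Real.Gamma (1 / 3)) ^ 3 / (π * (2 : ℝ) ^ ((1 : ℝ) / 3)) =
      ∑' n : ℕ,
        risingFactorial (2 / 3) n * risingFactorial (1 / 2) n * (102 * (n : ℝ) + 59) /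
          (risingFactorial (13 / 12) n * risingFactorial (19 / 12) n * (-288 : ℝ) ^ n) := by
  have hc : 0 < Gamma (2 / 3) * Gamma (1 / 2) / Gamma (13 / 6) :=
    div_pos (mul_pos (Real.Gamma_pos_of_pos (by norm_num)) (Real.Gamma_pos_of_pos (by norm_num)))
      (Real.Gamma_pos_of_pos (by norm_num))
  have h := hasSum_integral_beta_weight
  simp only [integral_beta_weight_eq_term] at h
  have h' := h.div_const (Gamma (2 / 3) * Gamma (1 / 2) / Gamma (13 / 6))
  simp only [mul_div_cancel_left₀ _ hc.ne'] at h'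
  exact ⟨h'.summable.abs, Gamma_evaluation.trans h'.tsum_eq.symm⟩
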